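/- Let Ω = B(0,R) ⊂ ℝⁿ be an open ball and let H : closure(Ω) × ℝⁿ → ℝ be continuous, satisfy (H1), (H2) and (H3c), be convex in p for each x (H5), and be uniformly superlinear in p: inf_x H(x,p)/|p| → +∞ as |p| → ∞ (H6). Let L(x,v) = sup_{p ∈ ℝⁿ} (p·v − H(x,p)) be the Legendre transform, A_x the set of absolutely continuous curves η : [0,∞) → ℝⁿ with η(0) = x and η(s) in the closure of Ω for all s ≥ 0, and u(x) = inf_{η ∈ A_x} ∫₀^∞ e^{−s} L(η(s), −η̇(s)) ds the value function. Then u is bounded and uniformly continuous on the closure of Ω. -/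

import Mathlib

open Metric Set MeasureTheory Filter
open scoped Topology NNReal RealInnerProductSpace

noncomputable section

abbrev Euc (n : ℕ) := EuclideanSpace ℝ (Fin n)

/-- `v` is a viscosity subsolution of `v + H(x, Dv) = 0` in the open set `Ω`. -/
def IsViscositySubsolutionIn {n : ℕ} (Ω : Set (Euc n)) (H : Euc n → Euc n → ℝ)
    (v : Euc n → ℝ) : Prop :=
  ∀ x ∈ Ω, ∀ φ : Euc n → ℝ, ContDiff ℝ 1 φ →
    IsLocalMaxOn (fun y => v y - φ y) Ω x → v x + H x (gradient φ x) ≤ 0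

/-- `v` is a viscosity supersolution of `v + H(x, Dv) = 0` on the closure of `Ω`. -/
def IsViscositySupersolutionOn {n : ℕ} (Ω : Set (Euc n)) (H : Euc n → Euc n → ℝ)
    (v : Euc n → ℝ) : Prop :=
  ∀ x ∈ closure Ω, ∀ φ : Euc n → ℝ, ContDiff ℝ 1 φ →
    IsLocalMinOn (fun y => v y - φ y) (closure Ω) x → 0 ≤ v x + H x (gradient φ x)

/-- `v` is a state-constraint viscosity solution on `Ω`. -/
def IsStateConstraintSolution {n : ℕ} (Ω : Set (Euc n)) (H : Euc n → Euc n → ℝ)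
    (v : Euc n → ℝ) : Prop :=
  ContinuousOn v (closure Ω) ∧ IsViscositySubsolutionIn Ω H v ∧
    IsViscositySupersolutionOn Ω H v

/-- Admissible curve/velocity pairs: `p.1` is the curve, `p.2` its (locally integrable)
velocity; the curve starts at `x`, stays in the closure of `Ω`, and has integrable cost. -/
def Curves {n : ℕ} (Ω : Set (Euc n)) (L : Euc n → Euc n → ℝ) (x : Euc n) :
    Set ((ℝ → Euc n) × (ℝ → Euc n)) :=
  {p | (∀ t : ℝ, 0 ≤ t → IntegrableOn p.2 (Icc 0 t) volume) ∧
    (∀ t : ℝ, 0 ≤ t → p.1 t = x + ∫ s in Icc (0:ℝ) t, p.2 s) ∧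
    (∀ t : ℝ, 0 ≤ t → p.1 t ∈ closure Ω) ∧
    IntegrableOn (fun s => Real.exp (-s) * L (p.1 s) (-p.2 s)) (Ioi (0:ℝ)) volume}

/-- The cost functional `J[x, η] = ∫₀^∞ e^{-s} L(η(s), -η̇(s)) ds`. -/
def costJ {n : ℕ} (L : Euc n → Euc n → ℝ) (p : (ℝ → Euc n) × (ℝ → Euc n)) : ℝ :=
  ∫ s in Ioi (0:ℝ), Real.exp (-s) * L (p.1 s) (-p.2 s)

/-- The value function `u(x) = inf_{η ∈ A_x} J[x, η]`. -/
def valueFun {n : ℕ} (Ω : Set (Euc n)) (L : Euc n → Euc n → ℝ) (x : Euc n) : ℝ :=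
  sInf (costJ L '' Curves Ω L x)

/-- The Legendre transform `L(x,v) = sup_p (p·v - H(x,p))`. -/
def legendreTransform {n : ℕ} (H : Euc n → Euc n → ℝ) (x v : Euc n) : ℝ :=
  ⨆ p : Euc n, (@inner ℝ _ _ p v - H x p)

variable {n : ℕ}

lemma inner_sub_le_of_superlinear {H : Euc n → Euc n → ℝ} {K : Set (Euc n)} {C₁ r M : ℝ}
    (hC₁ : 0 ≤ C₁) (hM : 0 ≤ M) (hH1 : ∀ x ∈ K, ∀ p : Euc n, -H x p ≤ C₁)
    (hr : ∀ p : Euc n, r ≤ ‖p‖ → ∀ x ∈ K, M * ‖p‖ ≤ H x p)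
    {x : Euc n} (hx : x ∈ K) {v : Euc n} (hv : ‖v‖ ≤ M) (p : Euc n) :
    inner ℝ p v - H x p ≤ M * |r| + C₁ := by
  have h1 : inner ℝ p v ≤ M * ‖p‖ :=
    (real_inner_le_norm p v).trans (by rw [mul_comm]; gcongr)
  have h3 : 0 ≤ M * |r| := by positivity
  rcases le_total r ‖p‖ with h | h
  · linarith [hr p h x hx]
  · have : M * ‖p‖ ≤ M * |r| := by gcongr; exact h.trans (le_abs_self r)
    linarith [hH1 x hx p]

lemma bddAbove_legendreTransform {H : Euc n → Euc n → ℝ} {K : Set (Euc n)} {C₁ : ℝ}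
    (hC₁ : 0 ≤ C₁) (hH1 : ∀ x ∈ K, ∀ p : Euc n, -H x p ≤ C₁)
    (hH6 : ∀ M : ℝ, ∃ r : ℝ, ∀ p : Euc n, r ≤ ‖p‖ → ∀ x ∈ K, M * ‖p‖ ≤ H x p)
    {x : Euc n} (hx : x ∈ K) (v : Euc n) :
    BddAbove (range fun p : Euc n => inner ℝ p v - H x p) := by
  obtain ⟨r, hr⟩ := hH6 ‖v‖
  exact ⟨_, forall_mem_range.2
    (inner_sub_le_of_superlinear hC₁ (norm_nonneg v) hH1 hr hx le_rfl)⟩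

/-- Prefixing an admissible curve with a segment traversed at constant velocity. -/
lemma exists_mem_Curves_costJ_eq {Ω : Set (Euc n)} {L : Euc n → Euc n → ℝ} {x y e : Euc n} {δ : ℝ}
    (hδ : 0 ≤ δ) (hx : y + δ • e = x)
    (hseg : ∀ t ∈ Icc 0 δ, y + t • e ∈ closure Ω)
    (hcost_int : IntegrableOn (fun s => Real.exp (-s) * L (y + s • e) (-e)) (Ioc 0 δ))
    {p : (ℝ → Euc n) × (ℝ → Euc n)} (hp : p ∈ Curves Ω L x) :
    ∃ q ∈ Curves Ω L y, costJ L q =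
      (∫ s in Ioc 0 δ, Real.exp (-s) * L (y + s • e) (-e)) + Real.exp (-δ) * costJ L p := by
  obtain ⟨hg, hη, hΩ, hJ⟩ := hp
  let γ : ℝ → Euc n := fun t => if t ≤ δ then y + t • e else p.1 (t - δ)
  let g : ℝ → Euc n := fun t => if t ≤ δ then e else p.2 (t - δ)
  have g_left : ∀ t ≤ δ, IntervalIntegrable g volume 0 t := fun t ht =>
    (intervalIntegrable_const (c := e)).congr fun s hs => by
      have : s ≤ δ := (hs.2).trans (max_le hδ ht)
      simp [g, this]
  have g_right : ∀ t, δ ≤ t → IntervalIntegrable g volume δ t := fun t ht => by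
    have h := (hg (t - δ) (by linarith))
    rw [integrableOn_Icc_iff_integrableOn_Ioc,
      ← intervalIntegrable_iff_integrableOn_Ioc_of_le (by linarith)] at h
    have h' := h.comp_sub_right δ
    rw [zero_add, sub_add_cancel] at h'
    refine h'.congr fun s hs => ?_
    rw [uIoc_of_le ht] at hs
    simp [g, not_le.2 hs.1]
  have int_left : ∀ t ≤ δ, ∫ s in (0:ℝ)..t, g s = t • e := fun t ht => by
    rw [intervalIntegral.integral_congr (g := fun _ => e)]
    · simp
    · intro s hs
      have : s ≤ δ := (hs.2).trans (max_le hδ ht)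
      simp [g, this]
  have int_right : ∀ t, δ ≤ t → ∫ s in δ..t, g s = ∫ s in (0:ℝ)..(t - δ), p.2 s := fun t ht => by
    have := intervalIntegral.integral_comp_sub_right (a := δ) (b := t) p.2 δ
    rw [sub_self] at this
    rw [← this]
    refine intervalIntegral.integral_congr_ae (ae_of_all _ fun s hs => ?_)
    rw [uIoc_of_le ht] at hs
    simp [g, not_le.2 hs.1]
  have g_all : ∀ t, 0 ≤ t → IntervalIntegrable g volume 0 t := fun t ht => by
    rcases le_total t δ with h | h
    · exact g_left t h
    · exact (g_left δ le_rfl).trans (g_right t h)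
  let F : ℝ → ℝ := fun s => Real.exp (-s) * L (p.1 s) (-p.2 s)
  have hpre : (fun s : ℝ => s - δ) ⁻¹' Ioi 0 = Ioi δ := by ext s; simp
  have hmp : MeasurePreserving (fun s : ℝ => s - δ) := measurePreserving_sub_right volume δ
  have hemb : MeasurableEmbedding (fun s : ℝ => s - δ) := measurableEmbedding_subRight δ
  have cost_left : EqOn (fun s => Real.exp (-s) * L (y + s • e) (-e))
      (fun s => Real.exp (-s) * L (γ s) (-g s)) (Ioc 0 δ) := fun s hs => by
    simp [γ, g, hs.2]
  have cost_right : EqOn (fun s => Real.exp (-δ) * F (s - δ))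
      (fun s => Real.exp (-s) * L (γ s) (-g s)) (Ioi δ) := fun s hs => by
    have : ¬ s ≤ δ := not_le.2 hs
    simp only [γ, g, F, this, if_false]
    rw [← mul_assoc, ← Real.exp_add]
    congr 2
    ring
  have hJ' : IntegrableOn (fun s => Real.exp (-δ) * F (s - δ)) (Ioi δ) := by
    have := (hmp.integrableOn_comp_preimage hemb (f := F) (s := Ioi 0)).2 hJ
    rw [hpre] at this
    exact this.const_mul _
  have hl := hcost_int.congr_fun cost_left measurableSet_Ioc
  have hr := hJ'.congr_fun cost_right measurableSet_Ioi
  refine ⟨(γ, g), ⟨fun t ht => ?_, fun t ht => ?_, fun t ht => ?_, ?_⟩, ?_⟩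
  · rw [integrableOn_Icc_iff_integrableOn_Ioc,
      ← intervalIntegrable_iff_integrableOn_Ioc_of_le ht]
    exact g_all t ht
  · change γ t = y + ∫ s in Icc 0 t, g s
    rw [integral_Icc_eq_integral_Ioc, ← intervalIntegral.integral_of_le ht]
    by_cases h : t ≤ δ
    · simp [γ, h, int_left t h]
    · have h' := (not_le.1 h).le
      rw [← intervalIntegral.integral_add_adjacent_intervals (g_left δ le_rfl) (g_right t h'),
        int_left δ le_rfl, int_right t h', ← add_assoc, hx]
      have := hη (t - δ) (by linarith)
      rw [integral_Icc_eq_integral_Ioc, ← intervalIntegral.integral_of_le (by linarith)] at this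
      simp [γ, h, this]
  · by_cases h : t ≤ δ
    · simpa [γ, h] using hseg t ⟨ht, h⟩
    · simpa [γ, h] using hΩ (t - δ) (by linarith [not_le.1 h])
  · rw [← Ioc_union_Ioi_eq_Ioi hδ]
    exact hl.union hr
  · change ∫ s in Ioi (0:ℝ), Real.exp (-s) * L (γ s) (-g s) = _
    rw [← Ioc_union_Ioi_eq_Ioi hδ, setIntegral_union Ioc_disjoint_Ioi_same measurableSet_Ioi hl hr,
      ← setIntegral_congr_fun measurableSet_Ioc cost_left,
      ← setIntegral_congr_fun measurableSet_Ioi cost_right, integral_const_mul, ← hpre,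
      hmp.setIntegral_preimage_emb hemb F]
    rfl

lemma integrableOn_exp_neg_mul_const (c : ℝ) :
    IntegrableOn (fun s => Real.exp (-s) * c) (Ioi 0) :=
  (integrableOn_exp_neg_Ioi 0).mul_const c

lemma integral_exp_neg_mul_const (c : ℝ) :
    ∫ s in Ioi (0:ℝ), Real.exp (-s) * c = c := by
  rw [integral_mul_const, integral_exp_neg_Ioi_zero, one_mul]

lemma neg_le_costJ {Ω : Set (Euc n)} {L : Euc n → Euc n → ℝ} {C : ℝ}
    (hL : ∀ x ∈ closure Ω, ∀ v, -C ≤ L x v) {x : Euc n}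
    {p : (ℝ → Euc n) × (ℝ → Euc n)} (hp : p ∈ Curves Ω L x) : -C ≤ costJ L p := by
  rw [← integral_exp_neg_mul_const (-C)]
  refine setIntegral_mono_on (integrableOn_exp_neg_mul_const _) hp.2.2.2 measurableSet_Ioi
    fun s hs => ?_
  gcongr
  exact hL _ (hp.2.2.1 s (le_of_lt hs)) _

lemma const_mem_Curves {Ω : Set (Euc n)} (L : Euc n → Euc n → ℝ) {x : Euc n}
    (hx : x ∈ closure Ω) : ((fun _ => x, fun _ => 0) : (ℝ → Euc n) × (ℝ → Euc n)) ∈ Curves Ω L x :=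
  ⟨fun _ _ => integrableOn_zero, fun _ _ => by simp, fun _ _ => hx,
    integrableOn_exp_neg_mul_const (L x (-0))⟩

section

variable {Ω : Set (Euc n)} {L : Euc n → Euc n → ℝ} {C : ℝ}

lemma bddBelow_costJ (hL : ∀ x ∈ closure Ω, ∀ v, -C ≤ L x v) (x : Euc n) :
    BddBelow (costJ L '' Curves Ω L x) :=
  ⟨-C, forall_mem_image.2 fun _ hp => neg_le_costJ hL hp⟩

lemma neg_le_valueFun (hL : ∀ x ∈ closure Ω, ∀ v, -C ≤ L x v) {x : Euc n}
    (hx : x ∈ closure Ω) : -C ≤ valueFun Ω L x :=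
  le_csInf ⟨_, mem_image_of_mem _ (const_mem_Curves L hx)⟩
    (forall_mem_image.2 fun _ hp => neg_le_costJ hL hp)

lemma valueFun_le (hL : ∀ x ∈ closure Ω, ∀ v, -C ≤ L x v) {x : Euc n}
    (hx : x ∈ closure Ω) : valueFun Ω L x ≤ L x 0 := by
  refine (csInf_le (bddBelow_costJ hL x) (mem_image_of_mem _ (const_mem_Curves L hx))).trans_eq ?_
  simp [costJ, integral_exp_neg_mul_const]

/-- On a convex domain, a Lagrangian that is bounded below, bounded above at speeds at most one,
and lower semicontinuous along curves has a Lipschitz value function. -/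
lemma valueFun_le_add (hΩ : Convex ℝ (closure Ω)) {B : ℝ}
    (hL : ∀ x ∈ closure Ω, ∀ v, -C ≤ L x v) (hB0 : 0 ≤ B) (hC0 : 0 ≤ C)
    (hB : ∀ x ∈ closure Ω, ∀ v, ‖v‖ ≤ 1 → L x v ≤ B)
    (hlsc : ∀ (γ : ℝ → Euc n) (v : Euc n), Continuous γ → (∀ s, γ s ∈ closure Ω) →
      LowerSemicontinuous fun s => L (γ s) v)
    {x y : Euc n} (hx : x ∈ closure Ω) (hy : y ∈ closure Ω) :
    valueFun Ω L y ≤ valueFun Ω L x + (B + C) * ‖x - y‖ := by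
  set δ := ‖x - y‖ with hδ
  rcases eq_or_ne x y with rfl | hne
  · simp [hδ]
  have hδ0 : 0 < δ := norm_pos_iff.2 (sub_ne_zero.2 hne)
  set e := δ⁻¹ • (x - y) with he
  have hxe : y + δ • e = x := by rw [he, smul_inv_smul₀ hδ0.ne']; abel
  have hen : ‖-e‖ ≤ 1 := by
    rw [norm_neg, he, norm_smul, norm_inv, Real.norm_of_nonneg hδ0.le, ← hδ,
      inv_mul_cancel₀ hδ0.ne']
  have hseg : ∀ t ∈ Icc 0 δ, y + t • e ∈ closure Ω := fun t ht => by
    have : y + t • e = y + (t * δ⁻¹) • (x - y) := by rw [he, smul_smul]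
    rw [this]
    exact hΩ.add_smul_sub_mem hy hx ⟨by have := ht.1; positivity,
      by rw [← div_eq_mul_inv]; exact (div_le_one hδ0).2 ht.2⟩
  have hmeas : Measurable fun s : ℝ => L (y + (max 0 (min s δ)) • e) (-e) :=
    (hlsc (fun s => y + (max 0 (min s δ)) • e) (-e) (by fun_prop)
      fun s => hseg _ ⟨le_max_left _ _, max_le hδ0.le (min_le_right _ _)⟩).measurable
  have hEq : EqOn (fun s : ℝ => L (y + (max 0 (min s δ)) • e) (-e))
      (fun s => L (y + s • e) (-e)) (Ioc 0 δ) := fun s hs => by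
    simp [min_eq_left hs.2, max_eq_right hs.1.le]
  have hcost_int : IntegrableOn (fun s => Real.exp (-s) * L (y + s • e) (-e)) (Ioc 0 δ) := by
    refine Integrable.mono' (g := fun _ => B + C) (integrable_const _) ?_ ?_
    · refine ((Real.measurable_exp.comp measurable_neg).mul hmeas).aestronglyMeasurable.congr ?_
      filter_upwards [ae_restrict_mem measurableSet_Ioc] with s hs
      exact congrArg (Real.exp (-s) * ·) (hEq hs)
    · filter_upwards [ae_restrict_mem measurableSet_Ioc] with s hs
      have hm := hseg s ⟨hs.1.le, hs.2⟩
      have h1 : Real.exp (-s) ≤ 1 := Real.exp_le_one_iff.2 (by linarith [hs.1])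
      have h2 : |L (y + s • e) (-e)| ≤ B + C :=
        abs_le.2 ⟨by linarith [hL _ hm (-e)], by linarith [hB _ hm _ hen]⟩
      rw [Real.norm_eq_abs, abs_mul, Real.abs_exp]
      calc _ ≤ 1 * |L (y + s • e) (-e)| := by gcongr
        _ ≤ _ := by rwa [one_mul]
  have hcost : ∫ s in Ioc 0 δ, Real.exp (-s) * L (y + s • e) (-e) ≤ B * δ := by
    calc _ ≤ ∫ s in Ioc 0 δ, B := by
          refine setIntegral_mono_on hcost_int (integrable_const _) measurableSet_Ioc fun s hs => ?_
          have h1 : Real.exp (-s) ≤ 1 := Real.exp_le_one_iff.2 (by linarith [hs.1])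
          calc _ ≤ Real.exp (-s) * B := by
                gcongr
                exact hB _ (hseg s ⟨hs.1.le, hs.2⟩) _ hen
            _ ≤ B := mul_le_of_le_one_left hB0 h1
      _ = B * δ := by simp [hδ0.le, mul_comm]
  rw [← sub_le_iff_le_add]
  refine le_csInf ⟨_, mem_image_of_mem _ (const_mem_Curves L hx)⟩
    (forall_mem_image.2 fun p hp => ?_)
  obtain ⟨q, hq, hqJ⟩ := exists_mem_Curves_costJ_eq hδ0.le hxe hseg hcost_int hp
  have h1 : valueFun Ω L y ≤ costJ L q := csInf_le (bddBelow_costJ hL y) (mem_image_of_mem _ hq)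
  have h2 := neg_le_costJ hL hp
  have h3 : Real.exp (-δ) ≤ 1 := Real.exp_le_one_iff.2 (by linarith)
  have h4 : 1 - δ ≤ Real.exp (-δ) := by linarith [Real.add_one_le_exp (-δ)]
  nlinarith [mul_nonneg (sub_nonneg.2 h3) (by linarith : 0 ≤ costJ L p + C),
    mul_nonneg (sub_nonneg.2 h4) hC0]

end

/-- Theorem 5.3: the value function of the state-constraint optimal control problem on a
ball is bounded and uniformly continuous up to the boundary. -/
theorem value_function_BUC {n : ℕ} (R : ℝ) (hR : 0 < R)
    (H : Euc n → Euc n → ℝ)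
    (hHcont : ContinuousOn (Function.uncurry H)
      (closure (ball (0 : Euc n) R) ×ˢ (univ : Set (Euc n))))
    (C₁ : ℝ) (hC₁ : 0 < C₁) (hH1 : ∀ x ∈ closure (ball (0 : Euc n) R), ∀ p : Euc n, -H x p ≤ C₁)
    (C₂ : ℝ) (hC₂ : 0 < C₂) (hH2 : ∀ x ∈ closure (ball (0 : Euc n) R), |H x 0| ≤ C₂)
    (hH3c : ∀ r > (0:ℝ), ∃ C > (0:ℝ), ∀ x ∈ closure (ball (0 : Euc n) R),
      ∀ y ∈ closure (ball (0 : Euc n) R), ∀ p q : Euc n, ‖p‖ ≤ r → ‖q‖ ≤ r →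
        |H x p - H y p| ≤ C * ‖x - y‖ ∧ |H x p - H x q| ≤ C * ‖p - q‖)
    (hH5 : ∀ x : Euc n, ConvexOn ℝ univ (H x))
    (hH6 : ∀ M : ℝ, ∃ r : ℝ, ∀ p : Euc n, r ≤ ‖p‖ →
      ∀ x ∈ closure (ball (0 : Euc n) R), M * ‖p‖ ≤ H x p) :
    (∃ M : ℝ, ∀ x ∈ closure (ball (0 : Euc n) R),
      |valueFun (ball (0 : Euc n) R) (legendreTransform H) x| ≤ M) ∧
    UniformContinuousOn (valueFun (ball (0 : Euc n) R) (legendreTransform H))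
      (closure (ball (0 : Euc n) R)) := by
  set L := legendreTransform H
  set Ω := ball (0 : Euc n) R
  have hbdd : ∀ x ∈ closure Ω, ∀ v : Euc n,
      BddAbove (range fun p : Euc n => inner ℝ p v - H x p) :=
    fun x hx v => bddAbove_legendreTransform hC₁.le hH1 hH6 hx v
  have hL : ∀ x ∈ closure Ω, ∀ v, -C₂ ≤ L x v := fun x hx v => by
    have h := le_ciSup (hbdd x hx v) 0
    rw [inner_zero_left] at h
    exact le_trans (by linarith [(abs_le.1 (hH2 x hx)).2]) h
  have hL0 : ∀ x ∈ closure Ω, L x 0 ≤ C₁ := fun x hx =>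
    ciSup_le fun p => by simpa using hH1 x hx p
  obtain ⟨r, hr⟩ := hH6 1
  have hB : ∀ x ∈ closure Ω, ∀ v, ‖v‖ ≤ 1 → L x v ≤ 1 * |r| + C₁ := fun x hx v hv =>
    ciSup_le (inner_sub_le_of_superlinear hC₁.le zero_le_one hH1 hr hx hv)
  have hB0 : 0 ≤ 1 * |r| + C₁ := by positivity
  have hlsc : ∀ (γ : ℝ → Euc n) (v : Euc n), Continuous γ → (∀ s, γ s ∈ closure Ω) →
      LowerSemicontinuous fun s => L (γ s) v := fun γ v hγ hmem => by
    refine lowerSemicontinuous_ciSup (fun s => hbdd _ (hmem s) v) fun p => ?_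
    have : Continuous fun s => H (γ s) p :=
      hHcont.comp_continuous (hγ.prodMk continuous_const) fun s => ⟨hmem s, mem_univ p⟩
    exact (continuous_const.sub this).lowerSemicontinuous
  refine ⟨⟨C₁ + C₂, fun x hx => abs_le.2 ⟨?_, ?_⟩⟩, ?_⟩
  · linarith [neg_le_valueFun hL hx]
  · linarith [valueFun_le hL hx, hL0 x hx]
  · refine (LipschitzOnWith.of_le_add_mul' (1 * |r| + C₁ + C₂)
      fun y hy x hx => ?_).uniformContinuousOn
    rw [dist_comm, dist_eq_norm]
    exact valueFun_le_add (convex_ball (0 : Euc n) R).closure hL hB0 hC₂.le hB hlsc hx hy
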